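/- Let d ≥ 1, m ∈ ℝ, and a ∈ S^m_{1,1}. For k ≥ 1 define d_k(x,ξ) := Σ_{j=max(0,k−2)}^{k+2} a_{j,k}(x,ξ) and the kernel U_k(x,z) := ∫_{ℝ^d} d_k(x,ξ) e^{2πi⟨x−z,ξ⟩} dξ. Then there is a constant C such that for every μ ∈ ℕ with μ ≥ 1, every cube Q with 2^{−μ} ≤ l(Q) < 2^{−μ+1}, every integer k with 1 ≤ k ≤ μ, and all x, y ∈ Q: ∫_{ℝ^d} |U_k(x,z) − U_k(y,z)| dz ≤ C · 2^{km} · 2^k l(Q). -/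

import Mathlib

noncomputable section

open MeasureTheory SchwartzMap Complex RealInnerProductSpace Filter
open scoped ENNReal NNReal ContDiff SchwartzMap

/-- Euclidean space `ℝ^d`. -/
abbrev RD (d : ℕ) : Type := EuclideanSpace ℝ (Fin d)

/-- Tempered distributions on `ℝ^d`. -/
abbrev TD (d : ℕ) : Type := 𝓢(RD d, ℂ) →L[ℂ] ℂ

/-- Fourier transform of a Schwartz function (with the convention
`f̂(ξ) = ∫ f(x) e^{-2πi⟨x,ξ⟩} dx`). -/
def fourierS {d : ℕ} (f : 𝓢(RD d, ℂ)) : 𝓢(RD d, ℂ) :=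
  SchwartzMap.fourierTransformCLM ℂ f

/-- Hörmander symbol class `S^m_{1,1}`: `a` is smooth and
`‖∂_ξ^α ∂_x^β a(x,ξ)‖ ≤ c_{α,β} (1+‖ξ‖)^{m-|α|+|β|}` for all orders of derivatives. -/
def IsSymbolS11 (d : ℕ) (m : ℝ) (a : RD d → RD d → ℂ) : Prop :=
  ContDiff ℝ ∞ (fun p : RD d × RD d => a p.1 p.2) ∧
  ∀ α β : ℕ, ∃ c : ℝ, ∀ x ξ : RD d,
    ‖iteratedFDeriv ℝ α (fun ξ' => iteratedFDeriv ℝ β (fun x' => a x' ξ') x) ξ‖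
      ≤ c * (1 + ‖ξ‖) ^ (m - (α : ℝ) + (β : ℝ))

/-- The pseudo-differential operator `T_a f(x) = ∫ a(x,ξ) f̂(ξ) e^{2πi⟨x,ξ⟩} dξ`
acting on a Schwartz function `f`. -/
def pdo {d : ℕ} (a : RD d → RD d → ℂ) (f : 𝓢(RD d, ℂ)) (x : RD d) : ℂ :=
  ∫ ξ, a x ξ * fourierS f ξ * Complex.exp (2 * Real.pi * Complex.I * ((⟪x, ξ⟫ : ℝ) : ℂ))

/-- Littlewood–Paley data: a Schwartz function `φ` with `φ̂` supported in
`{1/2 ≤ |ξ| ≤ 2}` and `Σ_{k∈ℤ} φ̂(2^{-k}ξ) = 1` for `ξ ≠ 0`, together with the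
low-frequency piece `Φ` determined by `Φ̂ = 1 - Σ_{k≥1} φ̂(2^{-k}·)`. -/
structure LPData (d : ℕ) where
  φ : 𝓢(RD d, ℂ)
  Φ : 𝓢(RD d, ℂ)
  supp_φ : ∀ ξ : RD d, fourierS φ ξ ≠ 0 → 1/2 ≤ ‖ξ‖ ∧ ‖ξ‖ ≤ 2
  sum_φ : ∀ ξ : RD d, ξ ≠ 0 → HasSum (fun k : ℤ => fourierS φ ((2:ℝ)^(-k) • ξ)) 1
  Φ_def : ∀ ξ : RD d, fourierS Φ ξ = 1 - ∑' k : ℕ, fourierS φ (((2:ℝ)^(k+1))⁻¹ • ξ)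

/-- The Littlewood–Paley convolution kernel: `Φ` for `k = 0` and
`φ_k = 2^{kd} φ(2^k ·)` for `k ≥ 1`. -/
def LPkernel {d : ℕ} (D : LPData d) : ℕ → RD d → ℂ
  | 0, x => D.Φ x
  | (k+1), x => (((2:ℝ)^((k+1) * d) : ℝ) : ℂ) * D.φ ((2:ℝ)^(k+1) • x)

/-- The Fourier transform of the `k`-th Littlewood–Paley kernel, i.e. `φ̂_k = φ̂(2^{-k}·)`
for `k ≥ 1` and `Φ̂` for `k = 0`. -/
def LPhat {d : ℕ} (D : LPData d) : ℕ → RD d → ℂ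
  | 0, ξ => fourierS D.Φ ξ
  | (k+1), ξ => fourierS D.φ (((2:ℝ)^(k+1))⁻¹ • ξ)

/-- Littlewood–Paley operator `Π_k g = φ_k ∗ g` (with `φ_0 := Φ`) acting on functions. -/
def LP {d : ℕ} (D : LPData d) (k : ℕ) (g : RD d → ℂ) (x : RD d) : ℂ :=
  ∫ y, LPkernel D k y * g (x - y)

/-- `Π*_k = Π_{k-1} + Π_k + Π_{k+1}` (with the convention `φ_{-1} := 0`). -/
def LPstar {d : ℕ} (D : LPData d) (k : ℕ) (g : RD d → ℂ) (x : RD d) : ℂ :=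
  (if k = 0 then 0 else LP D (k-1) g x) + LP D k g x + LP D (k+1) g x

open Classical in
/-- Pairing of a tempered distribution with a plain function: it gives `u ψ` if the
function is (the coercion of) a Schwartz function `ψ`, and `0` otherwise. -/
def pairing {d : ℕ} (u : TD d) (g : RD d → ℂ) : ℂ :=
  if h : ∃ ψ : 𝓢(RD d, ℂ), ⇑ψ = g then u h.choose else 0

/-- Fourier transform of a tempered distribution, `⟨û, ψ⟩ = ⟨u, ψ̂⟩`. -/
def fourierTD {d : ℕ} (u : TD d) : TD d :=
  u.comp (SchwartzMap.fourierTransformCLM ℂ)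

/-- Littlewood–Paley operator on tempered distributions:
`Π_k u (x) = ⟨u, φ_k(x - ·)⟩`. -/
def LPdist {d : ℕ} (D : LPData d) (k : ℕ) (u : TD d) (x : RD d) : ℂ :=
  pairing u (fun y => LPkernel D k (x - y))

/-- The symbol `a_{j,k}(x,ξ) = (φ_j ∗ a(·,ξ))(x) · φ̂_k(ξ)` (with `Φ` replacing `φ_0`). -/
def symbolPiece {d : ℕ} (D : LPData d) (a : RD d → RD d → ℂ) (j k : ℕ)
    (x ξ : RD d) : ℂ :=
  (∫ y, LPkernel D j y * a (x - y) ξ) * LPhat D k ξ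

/-- `T_{a_{j,k}} u (x) = ⟨û, a_{j,k}(x,·) e^{2πi⟨x,·⟩}⟩` for a tempered distribution `u`. -/
def pdoPieceD {d : ℕ} (D : LPData d) (a : RD d → RD d → ℂ) (j k : ℕ)
    (u : TD d) (x : RD d) : ℂ :=
  pairing (fourierTD u)
    (fun ξ => symbolPiece D a j k x ξ * Complex.exp (2 * Real.pi * Complex.I * ((⟪x, ξ⟫ : ℝ) : ℂ)))

/-- Partial sums `Σ_{j=0}^N Σ_{k=0}^N T_{a_{j,k}} u (x)`. -/
def pdoPartial {d : ℕ} (D : LPData d) (a : RD d → RD d → ℂ) (N : ℕ)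
    (u : TD d) (x : RD d) : ℂ :=
  ∑ j ∈ Finset.range (N+1), ∑ k ∈ Finset.range (N+1), pdoPieceD D a j k u x

/-- `T_a u` converges in `S'` to the tempered distribution `Tf`: the partial sums
`Σ_{j,k≤N} T_{a_{j,k}} u` (which are functions) converge to `Tf` weakly. -/
def ConvergesInSPrime {d : ℕ} (D : LPData d) (a : RD d → RD d → ℂ)
    (u : TD d) (Tf : TD d) : Prop :=
  ∀ ψ : 𝓢(RD d, ℂ),
    Tendsto (fun N => ∫ x, pdoPartial D a N u x * ψ x) atTop (nhds (Tf ψ))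

/-- The dyadic cube of level `ν` (side length `2^{-ν}`) indexed by `n ∈ ℤ^d`. -/
def dyadicCube (d : ℕ) (ν : ℤ) (n : Fin d → ℤ) : Set (RD d) :=
  {x | ∀ i, (n i : ℝ) * (2:ℝ)^(-ν) ≤ x i ∧ x i < ((n i : ℝ) + 1) * (2:ℝ)^(-ν)}

/-- The local quantity `(|P|⁻¹ ∫_P Σ_{k=k₀}^∞ 2^{skq} ‖g_k(x)‖^q dx)^{1/q}` for the
dyadic cube `P` of level `μ` indexed by `n` (so that `|P|⁻¹ = 2^{μd}`). -/
def cubePiece (d : ℕ) (μ : ℕ) (n : Fin d → ℤ) (k₀ : ℕ) (s q : ℝ)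
    (g : ℕ → RD d → ℂ) : ℝ≥0∞ :=
  ((2:ℝ≥0∞)^((μ:ℝ)*(d:ℝ)) *
    ∫⁻ x in dyadicCube d μ n,
      ∑' j : ℕ, (2:ℝ≥0∞)^(s*((k₀:ℝ)+(j:ℝ))*q) * (‖g (k₀+j) x‖₊ : ℝ≥0∞)^q) ^ (1/q)

/-- The `F_∞^{s,q}` norm (for `q < ∞`) of a function, computed from its
Littlewood–Paley pieces:
`‖Π_0 g‖_∞ + sup_{l(P)<1 dyadic} (|P|⁻¹ ∫_P Σ_{k=-log₂ l(P)}^∞ 2^{skq}|Π_k g|^q)^{1/q}`. -/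
def FinftyNormFun {d : ℕ} (D : LPData d) (s q : ℝ) (g : RD d → ℂ) : ℝ≥0∞ :=
  (⨆ x : RD d, (‖LP D 0 g x‖₊ : ℝ≥0∞)) +
  ⨆ (μ : ℕ) (_ : 1 ≤ μ) (n : Fin d → ℤ),
    cubePiece d μ n μ s q (fun k x => LP D k g x)

/-- The `F_∞^{s,q}` norm (for `q < ∞`) of a tempered distribution. -/
def FinftyNormDist {d : ℕ} (D : LPData d) (s q : ℝ) (u : TD d) : ℝ≥0∞ :=
  (⨆ x : RD d, (‖LPdist D 0 u x‖₊ : ℝ≥0∞)) +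
  ⨆ (μ : ℕ) (_ : 1 ≤ μ) (n : Fin d → ℤ),
    cubePiece d μ n μ s q (fun k x => LPdist D k u x)

/-- The (axis-parallel, closed) cube with corner `c` and side length `L`. -/
def cube (d : ℕ) (c : RD d) (L : ℝ) : Set (RD d) :=
  {x | ∀ i, c i ≤ x i ∧ x i ≤ c i + L}

/-- The average of `g` over the cube with corner `c` and side length `L`. -/
def cubeMean {d : ℕ} (c : RD d) (L : ℝ) (g : RD d → ℂ) : ℂ :=
  (L^d)⁻¹ • ∫ x in cube d c L, g x

/-- The `bmo` norm (local BMO):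
`sup_{l(Q)≥1} |Q|⁻¹∫_Q |g| + sup_{l(Q)<1} |Q|⁻¹∫_Q |g - g_Q|`, over all cubes `Q`. -/
def bmoNorm (d : ℕ) (g : RD d → ℂ) : ℝ≥0∞ :=
  (⨆ (c : RD d) (L : ℝ) (_ : 1 ≤ L),
    ENNReal.ofReal ((L^d)⁻¹) * ∫⁻ x in cube d c L, (‖g x‖₊ : ℝ≥0∞)) +
  (⨆ (c : RD d) (L : ℝ) (_ : 0 < L) (_ : L < 1),
    ENNReal.ofReal ((L^d)⁻¹) * ∫⁻ x in cube d c L, (‖g x - cubeMean c L g‖₊ : ℝ≥0∞))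

/-- The Peetre maximal function `𝔐_{σ,R} g(x) = sup_y ‖g(x-y)‖/(1+R‖y‖)^σ`. -/
def peetre {d : ℕ} (σ R : ℝ) (g : RD d → ℂ) (x : RD d) : ℝ≥0∞ :=
  ⨆ y : RD d, (‖g (x - y)‖₊ : ℝ≥0∞) / ENNReal.ofReal ((1 + R * ‖y‖) ^ σ)

/-- `g` has (distributional) Fourier support contained in `K`: the pairing
`⟨ĝ, ψ⟩ = ∫ g · ψ̂` vanishes for every Schwartz `ψ` whose support does not meet `K`. -/
def HasFourierSupportIn {d : ℕ} (g : RD d → ℂ) (K : Set (RD d)) : Prop :=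
  ∀ ψ : 𝓢(RD d, ℂ), tsupport ⇑ψ ∩ K = ∅ → ∫ x, g x * fourierS ψ x = 0

/-- The near-diagonal symbol `d_k(x,ξ) = Σ_{j=max(0,k-2)}^{k+2} a_{j,k}(x,ξ)`. -/
def dsym {d : ℕ} (D : LPData d) (a : RD d → RD d → ℂ) (k : ℕ) (x ξ : RD d) : ℂ :=
  ∑ j ∈ Finset.Icc (k-2) (k+2), symbolPiece D a j k x ξ

/-- The kernel `U_k(x,z) = ∫ d_k(x,ξ) e^{2πi⟨x-z,ξ⟩} dξ` of `T_{d_k}`. -/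
def Ukernel {d : ℕ} (D : LPData d) (a : RD d → RD d → ℂ) (k : ℕ) (x z : RD d) : ℂ :=
  ∫ ξ, dsym D a k x ξ * Complex.exp (2 * Real.pi * Complex.I * ((⟪x - z, ξ⟫ : ℝ) : ℂ))

/-- The frequency annulus `{1/2 ≤ |η| ≤ 2}`. -/
def freqAnnulus (d : ℕ) : Set (RD d) := {η | 1/2 ≤ ‖η‖ ∧ ‖η‖ ≤ 2}

lemma isClosed_freqAnnulus (d : ℕ) : IsClosed (freqAnnulus d) :=
  (isClosed_le continuous_const continuous_norm).inter
    (isClosed_le continuous_norm continuous_const)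

lemma freqAnnulus_subset_closedBall (d : ℕ) :
    freqAnnulus d ⊆ Metric.closedBall (0 : RD d) 2 := fun η hη => by
  simpa using hη.2

lemma isCompact_freqAnnulus (d : ℕ) : IsCompact (freqAnnulus d) :=
  (isCompact_closedBall (0 : RD d) 2).of_isClosed_subset (isClosed_freqAnnulus d)
    (freqAnnulus_subset_closedBall d)

/-- `f` is smooth and its derivatives of order at most `N` are bounded by `M` on the annulus. -/
def BoundedOnAnnulus {d : ℕ} (N : ℕ) (M : ℝ) (f : RD d → ℂ) : Prop :=
  ContDiff ℝ ∞ f ∧ ∀ n ≤ N, ∀ η ∈ freqAnnulus d, ‖iteratedFDeriv ℝ n f η‖ ≤ M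

lemma BoundedOnAnnulus.mul {d N : ℕ} {M₁ M₂ : ℝ} {f g : RD d → ℂ}
    (hM₁ : 0 ≤ M₁) (hM₂ : 0 ≤ M₂) (hf : BoundedOnAnnulus N M₁ f) (hg : BoundedOnAnnulus N M₂ g) :
    BoundedOnAnnulus N (2 ^ N * (M₁ * M₂)) (fun η => f η * g η) := by
  refine ⟨hf.1.mul hg.1, fun n hn η hη => ?_⟩
  calc _ ≤ _ := norm_iteratedFDeriv_mul_le hf.1 hg.1 η (n := n) (by exact_mod_cast le_top)
    _ ≤ ∑ i ∈ Finset.range (n + 1), (n.choose i : ℝ) * (M₁ * M₂) := by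
        refine Finset.sum_le_sum fun i hi => ?_
        rw [mul_assoc]
        have hi' : i ≤ n := by simpa [Nat.lt_succ_iff] using hi
        gcongr
        · exact hf.2 i (hi'.trans hn) η hη
        · exact hg.2 (n - i) ((Nat.sub_le _ _).trans hn) η hη
    _ = 2 ^ n * (M₁ * M₂) := by
        rw [← Finset.sum_mul]
        exact_mod_cast congrArg (fun t : ℝ => t * (M₁ * M₂))
          (by exact_mod_cast Nat.sum_range_choose n)
    _ ≤ _ := by gcongr; norm_num

lemma BoundedOnAnnulus.add {d N : ℕ} {M₁ M₂ : ℝ} {f g : RD d → ℂ}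
    (hf : BoundedOnAnnulus N M₁ f) (hg : BoundedOnAnnulus N M₂ g) :
    BoundedOnAnnulus N (M₁ + M₂) (fun η => f η + g η) := by
  refine ⟨hf.1.add hg.1, fun n hn η hη => ?_⟩
  have hn' : (n : WithTop ℕ∞) ≤ ((⊤ : ℕ∞) : WithTop ℕ∞) := by exact_mod_cast le_top
  have := iteratedFDeriv_add_apply (𝕜 := ℝ) (x := η) (hf.1.of_le hn').contDiffAt
    (hg.1.of_le hn').contDiffAt
  change ‖iteratedFDeriv ℝ n (f + g) η‖ ≤ _
  rw [this]
  exact (norm_add_le _ _).trans (add_le_add (hf.2 n hn η hη) (hg.2 n hn η hη))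

lemma boundedOnAnnulus_schwartz {d : ℕ} (N : ℕ) (f : 𝓢(RD d, ℂ)) :
    ∃ M, 0 ≤ M ∧ BoundedOnAnnulus N M f := by
  choose C hC0 hC using fun n => f.decay 0 n
  refine ⟨∑ n ∈ Finset.range (N + 1), C n, Finset.sum_nonneg fun n _ => (hC0 n).le,
    f.smooth ⊤, fun n hn η _ => ?_⟩
  have h1 : ‖iteratedFDeriv ℝ n f η‖ ≤ C n := by simpa using hC n η
  exact h1.trans (Finset.single_le_sum (f := C) (fun n _ => (hC0 n).le)
    (Finset.mem_range.2 (Nat.lt_succ_of_le hn)))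

lemma boundedOnAnnulus_clm {d : ℕ} (N : ℕ) (ℓ : RD d →L[ℝ] ℂ) :
    BoundedOnAnnulus N (2 * ‖ℓ‖) ℓ := by
  refine ⟨ℓ.contDiff, fun n _ η hη => ?_⟩
  rcases n with _ | _ | n
  · rw [norm_iteratedFDeriv_zero, mul_comm]
    exact ℓ.le_opNorm_of_le hη.2
  · rw [zero_add, norm_iteratedFDeriv_one, ℓ.fderiv]
    linarith [norm_nonneg ℓ]
  · have h : fderiv ℝ (ℓ : RD d → ℂ) = fun _ => ℓ := by ext1 x; exact ℓ.fderiv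
    rw [← norm_iteratedFDeriv_fderiv, h, iteratedFDeriv_const_of_ne (by omega)]
    simp

/-- A smooth function supported in the annulus has a rapidly decaying Fourier integral,
quantitatively in terms of its derivatives. -/
lemma exists_fourier_decay (d N : ℕ) : ∃ C, 0 ≤ C ∧ ∀ (M : ℝ) (h : RD d → ℂ), 0 ≤ M →
    BoundedOnAnnulus N M h → (∀ η, h η ≠ 0 → η ∈ freqAnnulus d) → ∀ w : RD d,
    (1 + ‖w‖) ^ N * ‖∫ η, h η * Complex.exp (2 * Real.pi * Complex.I * ((⟪w, η⟫ : ℝ) : ℂ))‖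
      ≤ C * M := by
  set V := volume.real (freqAnnulus d)
  refine ⟨2 ^ (N - 1) * (V + 2 ^ N * ((N + 1) * V)), by positivity,
    fun M h hM hb hsupp w => ?_⟩
  have hts : tsupport h ⊆ freqAnnulus d := closure_minimal hsupp (isClosed_freqAnnulus d)
  have hcs : HasCompactSupport h := (isCompact_freqAnnulus d).of_isClosed_subset
    (isClosed_tsupport h) hts
  have hzero : ∀ n η, η ∉ freqAnnulus d → iteratedFDeriv ℝ n h η = 0 := fun n η hη =>
    image_eq_zero_of_notMem_tsupport fun hη' =>
      hη (hts (tsupport_iteratedFDeriv_subset n hη'))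
  have hcont : ∀ n : ℕ, Continuous (iteratedFDeriv ℝ n h) := fun n =>
    hb.1.continuous_iteratedFDeriv (by exact_mod_cast le_top)
  have hint : ∀ k n : ℕ, Integrable (fun v => ‖v‖ ^ k * ‖iteratedFDeriv ℝ n h v‖) := by
    intro k n
    refine Continuous.integrable_of_hasCompactSupport (by have := hcont n; fun_prop) ?_
    exact ((hcs.iteratedFDeriv n).norm).mul_left
  have hI : ∀ n ≤ N, ∫ v, ‖iteratedFDeriv ℝ n h v‖ ≤ V * M := by
    intro n hn
    rw [← setIntegral_eq_integral_of_forall_compl_eq_zero (s := freqAnnulus d)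
      (fun x hx => by rw [hzero n x hx, norm_zero]), mul_comm V]
    refine (Real.le_norm_self _).trans
      (norm_setIntegral_le_of_norm_le_const (isCompact_freqAnnulus d).measure_lt_top
        fun x hx => ?_)
    rw [norm_norm]
    exact hb.2 n hn x hx
  have hF : ∫ η, h η * Complex.exp (2 * Real.pi * Complex.I * ((⟪w, η⟫ : ℝ) : ℂ)) =
      FourierTransform.fourier h (-w) := by
    rw [Real.fourier_eq']
    refine integral_congr_ae (ae_of_all _ fun η => ?_)
    simp only [smul_eq_mul, inner_neg_right, real_inner_comm]
    rw [mul_comm]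
    congr 2
    push_cast
    ring
  have hpow : ‖w‖ ^ N * ‖FourierTransform.fourier h (-w)‖ ≤ 2 ^ N * ((N + 1) * V * M) := by
    have := Real.pow_mul_norm_iteratedFDeriv_fourier_le (f := h) (K := ⊤) (N := ⊤)
      hb.1 (fun k n _ _ => hint k n) (k := 0) (n := N) le_top le_top (-w)
    simp only [norm_neg, norm_iteratedFDeriv_zero, pow_zero, one_mul, CharP.cast_eq_zero,
      mul_zero, zero_add, Finset.range_one, Finset.singleton_product, Finset.sum_map,
      Function.Embedding.coeFn_mk] at this
    refine this.trans ?_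
    gcongr
    refine (Finset.sum_le_sum fun n hn => hI n (by simpa [Nat.lt_succ_iff] using hn)).trans ?_
    simp [mul_assoc]
  have hone : ‖FourierTransform.fourier h (-w)‖ ≤ V * M := by
    rw [← hF]
    refine (norm_integral_le_integral_norm _).trans ?_
    refine le_trans (le_of_eq (integral_congr_ae (ae_of_all _ fun η => ?_))) (hI 0 N.zero_le)
    simp only [norm_mul, norm_iteratedFDeriv_zero]
    have : (2 * Real.pi * Complex.I * ((⟪w, η⟫ : ℝ) : ℂ)) =
      ((2 * Real.pi * ⟪w, η⟫ : ℝ) : ℂ) * Complex.I := by push_cast; ring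
    rw [this, Complex.norm_exp_ofReal_mul_I, mul_one]
  rw [hF]
  calc _ ≤ (2 ^ (N - 1) * (1 ^ N + ‖w‖ ^ N)) * ‖FourierTransform.fourier h (-w)‖ := by
        gcongr
        exact add_pow_le zero_le_one (norm_nonneg w) N
    _ = 2 ^ (N - 1) * (‖FourierTransform.fourier h (-w)‖ +
          ‖w‖ ^ N * ‖FourierTransform.fourier h (-w)‖) := by ring
    _ ≤ 2 ^ (N - 1) * (V * M + 2 ^ N * ((N + 1) * V * M)) := by gcongr
    _ = _ := by ring

lemma rpow_le_three_rpow_abs {r : ℝ} (h₁ : 1 / 3 ≤ r) (h₂ : r ≤ 3) (q : ℝ) :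
    r ^ q ≤ 3 ^ |q| := by
  have hr : 0 < r := by linarith
  rcases le_total 0 q with hq | hq
  · rw [abs_of_nonneg hq]
    exact Real.rpow_le_rpow hr.le h₂ hq
  · rw [abs_of_nonpos hq, ← inv_inv r, Real.inv_rpow (by positivity),
      ← Real.rpow_neg (by positivity)]
    refine Real.rpow_le_rpow (by positivity) ?_ (by linarith)
    rw [inv_le_comm₀ hr (by norm_num)]
    linarith

/-- Dilating a symbol of order `p` by `s ≥ 1` gives a function of size `s ^ p` on the annulus. -/
lemma boundedOnAnnulus_dilate {d : ℕ} (N : ℕ) (p : ℝ) {f : RD d → ℂ} (hf : ContDiff ℝ ∞ f)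
    {c s : ℝ} (hc : 0 ≤ c) (hs : 1 ≤ s)
    (hb : ∀ n ≤ N, ∀ ξ, ‖iteratedFDeriv ℝ n f ξ‖ ≤ c * (1 + ‖ξ‖) ^ (p - (n : ℝ))) :
    BoundedOnAnnulus N (3 ^ (|p| + N) * c * s ^ p) (fun η => f (s • η)) := by
  have hs0 : 0 < s := by linarith
  refine ⟨hf.comp (contDiff_const_smul s), fun n hn η hη => ?_⟩
  rw [iteratedFDeriv_comp_const_smul s (hf.of_le (by exact_mod_cast le_top)), norm_smul,
    norm_pow, Real.norm_of_nonneg hs0.le]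
  have hr : 1 + ‖s • η‖ = s * (s⁻¹ + ‖η‖) := by
    rw [norm_smul, Real.norm_of_nonneg hs0.le]; field_simp
  have hs1 : s⁻¹ ≤ 1 := inv_le_one_of_one_le₀ hs
  have hs2 : 0 < s⁻¹ := by positivity
  have hη1 := hη.1
  have hη2 := hη.2
  have key := rpow_le_three_rpow_abs (r := s⁻¹ + ‖η‖) (by linarith) (by linarith) (p - n)
  have habs : |p - n| ≤ |p| + N := by
    refine (abs_sub _ _).trans ?_
    rw [Nat.abs_cast]
    gcongr
  calc s ^ n * ‖iteratedFDeriv ℝ n f (s • η)‖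
      ≤ s ^ n * (c * (s * (s⁻¹ + ‖η‖)) ^ (p - (n : ℝ))) := by
        gcongr
        rw [← hr]
        exact hb n hn _
    _ = (s⁻¹ + ‖η‖) ^ (p - (n : ℝ)) * c * s ^ p := by
        rw [Real.mul_rpow hs0.le (by positivity), Real.rpow_sub_natCast hs0.ne']
        field_simp
    _ ≤ 3 ^ (|p| + N) * c * s ^ p := by
        gcongr
        exact key.trans (Real.rpow_le_rpow_of_exponent_le (by norm_num) habs)

lemma IsSymbolS11.exists_uniform_bound {d : ℕ} {m : ℝ} {a : RD d → RD d → ℂ}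
    (ha : IsSymbolS11 d m a) (N β : ℕ) : ∃ c, 0 ≤ c ∧ ∀ n ≤ N, ∀ x ξ : RD d,
      ‖iteratedFDeriv ℝ n (fun ξ' => iteratedFDeriv ℝ β (fun x' => a x' ξ') x) ξ‖
        ≤ c * (1 + ‖ξ‖) ^ (m + β - (n : ℝ)) := by
  choose c hc using fun n => ha.2 n β
  refine ⟨∑ n ∈ Finset.range (N + 1), |c n|, Finset.sum_nonneg fun n _ => abs_nonneg _,
    fun n hn x ξ => ?_⟩
  rw [show m + β - (n : ℝ) = m - n + β by ring]
  refine (hc n x ξ).trans ?_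
  gcongr
  exact (le_abs_self _).trans (Finset.single_le_sum (f := fun n => |c n|)
    (fun n _ => abs_nonneg _) (Finset.mem_range.2 (Nat.lt_succ_of_le hn)))

lemma IsSymbolS11.contDiff_right {d : ℕ} {m : ℝ} {a : RD d → RD d → ℂ}
    (ha : IsSymbolS11 d m a) (x : RD d) : ContDiff ℝ ∞ (a x) :=
  ha.1.comp (contDiff_prodMk_right x)

lemma IsSymbolS11.contDiff_left {d : ℕ} {m : ℝ} {a : RD d → RD d → ℂ}
    (ha : IsSymbolS11 d m a) (ξ : RD d) : ContDiff ℝ ∞ (fun x => a x ξ) :=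
  ha.1.comp (contDiff_prodMk_left ξ)

lemma IsSymbolS11.contDiff_fderiv {d : ℕ} {m : ℝ} {a : RD d → RD d → ℂ}
    (ha : IsSymbolS11 d m a) (x : RD d) :
    ContDiff ℝ ∞ (fun ξ => fderiv ℝ (fun x' => a x' ξ) x) := by
  refine ContDiff.fderiv (f := fun ξ x' => a x' ξ) (g := fun _ => x)
    (m := ((⊤ : ℕ∞) : WithTop ℕ∞)) ?_ contDiff_const ?_
  · exact ha.1.comp (contDiff_snd.prodMk contDiff_fst)
  · rfl

lemma IsSymbolS11.exists_bound_zero {d : ℕ} {m : ℝ} {a : RD d → RD d → ℂ}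
    (ha : IsSymbolS11 d m a) (N : ℕ) : ∃ c, 0 ≤ c ∧ ∀ n ≤ N, ∀ x ξ : RD d,
      ‖iteratedFDeriv ℝ n (a x) ξ‖ ≤ c * (1 + ‖ξ‖) ^ (m - (n : ℝ)) := by
  obtain ⟨c, hc, h⟩ := ha.exists_uniform_bound N 0
  refine ⟨c, hc, fun n hn x ξ => ?_⟩
  have := h n hn x ξ
  simp only [iteratedFDeriv_zero_eq_comp, Nat.cast_zero, add_zero] at this
  rwa [← LinearIsometryEquiv.norm_iteratedFDeriv_comp_left
    (continuousMultilinearCurryFin0 ℝ (RD d) ℂ).symm]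

lemma IsSymbolS11.exists_bound_one {d : ℕ} {m : ℝ} {a : RD d → RD d → ℂ}
    (ha : IsSymbolS11 d m a) (N : ℕ) : ∃ c, 0 ≤ c ∧ ∀ n ≤ N, ∀ x u ξ : RD d,
      ‖iteratedFDeriv ℝ n (fun ξ' => fderiv ℝ (fun x' => a x' ξ') x u) ξ‖
        ≤ (c * ‖u‖) * (1 + ‖ξ‖) ^ (m + 1 - (n : ℝ)) := by
  obtain ⟨c, hc, h⟩ := ha.exists_uniform_bound N 1
  refine ⟨c, hc, fun n hn x u ξ => ?_⟩
  have h1 : ‖iteratedFDeriv ℝ n (fun ξ' => fderiv ℝ (fun x' => a x' ξ') x) ξ‖ ≤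
      c * (1 + ‖ξ‖) ^ (m + 1 - (n : ℝ)) := by
    have := h n hn x ξ
    rw [Nat.cast_one] at this
    convert this using 1
    have e : (fun ξ' => iteratedFDeriv ℝ 1 (fun x' => a x' ξ') x) =
        (continuousMultilinearCurryFin1 ℝ (RD d) ℂ).symm ∘
          (fun ξ' => fderiv ℝ (fun x' => a x' ξ') x) := by
      ext ξ' v
      simp [iteratedFDeriv_one_apply]
    rw [e, LinearIsometryEquiv.norm_iteratedFDeriv_comp_left]
  have h2 := (ContinuousLinearMap.apply ℝ ℂ u).norm_iteratedFDeriv_comp_left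
    (x := ξ) (n := n) (ha.contDiff_fderiv x).contDiffAt (by exact_mod_cast le_top)
  refine h2.trans ?_
  have h3 : ‖ContinuousLinearMap.apply ℝ ℂ u‖ ≤ ‖u‖ :=
    ContinuousLinearMap.opNorm_le_bound _ (norm_nonneg _) fun f => by
      simpa [mul_comm] using f.le_opNorm u
  calc _ ≤ ‖u‖ * (c * (1 + ‖ξ‖) ^ (m + 1 - (n : ℝ))) := by gcongr
    _ = _ := by ring

/-- The plane wave `η ↦ e^{2πi⟨w,η⟩}`. -/
def planeWave {d : ℕ} (w η : RD d) : ℂ :=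
  Complex.exp (2 * Real.pi * Complex.I * ((⟪w, η⟫ : ℝ) : ℂ))

lemma norm_planeWave {d : ℕ} (w η : RD d) : ‖planeWave w η‖ = 1 := by
  have : (2 * Real.pi * Complex.I * ((⟪w, η⟫ : ℝ) : ℂ)) =
    ((2 * Real.pi * ⟪w, η⟫ : ℝ) : ℂ) * Complex.I := by push_cast; ring
  rw [planeWave, this, Complex.norm_exp_ofReal_mul_I]

lemma continuous_planeWave {d : ℕ} (w : RD d) : Continuous (planeWave w) := by
  unfold planeWave
  fun_prop

/-- The linear phase `η ↦ 2πi⟨v,η⟩`. -/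
def linearPhase {d : ℕ} (v : RD d) : RD d →L[ℝ] ℂ :=
  (2 * Real.pi * Complex.I : ℂ) • (Complex.ofRealCLM.comp (innerSL ℝ v))

lemma linearPhase_apply {d : ℕ} (v η : RD d) :
    linearPhase v η = 2 * Real.pi * Complex.I * ((⟪v, η⟫ : ℝ) : ℂ) := by
  simp [linearPhase]

lemma norm_linearPhase_le {d : ℕ} (v : RD d) : ‖linearPhase v‖ ≤ 2 * Real.pi * ‖v‖ := by
  refine ContinuousLinearMap.opNorm_le_bound _ (by positivity) fun η => ?_
  rw [linearPhase_apply]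
  simp only [norm_mul, Complex.norm_I, Complex.norm_real, mul_one, Complex.norm_ofNat,
    Real.norm_of_nonneg Real.pi_pos.le]
  rw [mul_assoc (2 * Real.pi)]
  gcongr
  exact norm_inner_le_norm v η

lemma hasDerivAt_planeWave_line {d : ℕ} (w v η : RD d) (t : ℝ) :
    HasDerivAt (fun t : ℝ => planeWave (w + t • v) η)
      (planeWave (w + t • v) η * linearPhase v η) t := by
  have h1 : HasDerivAt (fun t : ℝ => ⟪w + t • v, η⟫) ⟪v, η⟫ t := by
    have : (fun t : ℝ => ⟪w + t • v, η⟫) = fun t : ℝ => ⟪w, η⟫ + t * ⟪v, η⟫ := by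
      ext t
      rw [inner_add_left, real_inner_smul_left]
    rw [this]
    simpa using ((hasDerivAt_id t).mul_const ⟪v, η⟫).const_add ⟪w, η⟫
  rw [linearPhase_apply]
  exact (h1.ofReal_comp.const_mul (2 * Real.pi * Complex.I : ℂ)).cexp

/-- The rescaled kernel `∫ a(x, sη) ψ(η) e^{2πi⟨w,η⟩} dη`. -/
def blockKernel {d : ℕ} (a : RD d → RD d → ℂ) (ψ : 𝓢(RD d, ℂ)) (s : ℝ) (x w : RD d) : ℂ :=
  ∫ η, a x (s • η) * ψ η * planeWave w η

/-- The amplitude obtained by differentiating `a(x + tu, sη) ψ(η) e^{2πi⟨w + tsu,η⟩}` in `t`. -/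
def derivAmplitude {d : ℕ} (a : RD d → RD d → ℂ) (ψ : 𝓢(RD d, ℂ)) (s : ℝ) (u x η : RD d) : ℂ :=
  (fderiv ℝ (fun x' => a x' (s • η)) x u + a x (s • η) * linearPhase (s • u) η) * ψ η

lemma exists_boundedOnAnnulus_derivAmplitude {d : ℕ} {m : ℝ} {a : RD d → RD d → ℂ}
    (ha : IsSymbolS11 d m a) (ψ : 𝓢(RD d, ℂ)) (N : ℕ) :
    ∃ K, 0 ≤ K ∧ ∀ s : ℝ, 1 ≤ s → ∀ u x : RD d,
      BoundedOnAnnulus N (K * (s ^ m * (s * ‖u‖))) (derivAmplitude a ψ s u x) := by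
  obtain ⟨c₀, hc₀, h₀⟩ := ha.exists_bound_zero N
  obtain ⟨c₁, hc₁, h₁⟩ := ha.exists_bound_one N
  obtain ⟨M, hM, hψ⟩ := boundedOnAnnulus_schwartz N ψ
  refine ⟨2 ^ N * ((3 ^ (|m + 1| + N) * c₁ +
    2 ^ N * (3 ^ (|m| + N) * c₀ * (2 * (2 * Real.pi)))) * M), by positivity,
    fun s hs u x => ?_⟩
  have hs0 : 0 < s := by linarith
  have hP := boundedOnAnnulus_dilate N (m + 1) (f := fun ξ => fderiv ℝ (fun x' => a x' ξ) x u)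
    ((ha.contDiff_fderiv x).clm_apply contDiff_const) (by positivity) hs
    (fun n hn ξ => h₁ n hn x u ξ)
  have hQ := boundedOnAnnulus_dilate N m (ha.contDiff_right x) hc₀ hs
    (fun n hn ξ => h₀ n hn x ξ)
  have hL := boundedOnAnnulus_clm N (linearPhase (s • u))
  have hall := (hP.add (hQ.mul (by positivity) (by positivity) hL)).mul (by positivity) hM hψ
  refine ⟨hall.1, fun n hn η hη => (hall.2 n hn η hη).trans ?_⟩
  have hl : ‖linearPhase (s • u)‖ ≤ 2 * Real.pi * (s * ‖u‖) := by
    simpa [norm_smul, abs_of_pos hs0] using norm_linearPhase_le (s • u)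
  calc _ ≤ 2 ^ N * ((3 ^ (|m + 1| + N) * (c₁ * ‖u‖) * s ^ (m + 1) + 2 ^ N *
          (3 ^ (|m| + N) * c₀ * s ^ m * (2 * (2 * Real.pi * (s * ‖u‖))))) * M) := by gcongr
    _ = _ := by
      rw [Real.rpow_add_one hs0.ne']
      ring

lemma exists_blockKernel_sub_le {d : ℕ} {m : ℝ} {a : RD d → RD d → ℂ}
    (ha : IsSymbolS11 d m a) (ψ : 𝓢(RD d, ℂ)) (hψ : ∀ η, ψ η ≠ 0 → η ∈ freqAnnulus d)
    (N : ℕ) {B : ℝ} (hB : 0 ≤ B) :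
    ∃ C, 0 ≤ C ∧ ∀ s : ℝ, 1 ≤ s → ∀ u x w : RD d, s * ‖u‖ ≤ B →
      (1 + ‖w‖) ^ N * ‖blockKernel a ψ s (x + u) (w + s • u) - blockKernel a ψ s x w‖
        ≤ C * (s ^ m * (s * ‖u‖)) := by
  obtain ⟨C, hC, hdecay⟩ := exists_fourier_decay d N
  obtain ⟨K, hK, hamp⟩ := exists_boundedOnAnnulus_derivAmplitude ha ψ N
  refine ⟨(1 + B) ^ N * (C * K), by positivity, fun s hs u x w hu => ?_⟩
  have hs0 : 0 < s := by linarith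
  set M := K * (s ^ m * (s * ‖u‖)) with hMdef
  have hM : 0 ≤ M := by positivity
  have hcs : HasCompactSupport ψ := (isCompact_freqAnnulus d).of_isClosed_subset
    (isClosed_tsupport ψ) (closure_minimal hψ (isClosed_freqAnnulus d))
  have hsupp : ∀ y η, derivAmplitude a ψ s u y η ≠ 0 → η ∈ freqAnnulus d := fun y η h =>
    hψ η (right_ne_zero_of_mul h)
  have hFcont : ∀ y v, Continuous fun η => a y (s • η) * ψ η * planeWave v η := fun y v =>
    (((ha.contDiff_right y).continuous.comp (continuous_const_smul s)).mul ψ.continuous).mul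
      (continuous_planeWave v)
  have hderiv : ∀ t : ℝ, HasDerivAt (fun t : ℝ => blockKernel a ψ s (x + t • u) (w + t • s • u))
      (∫ η, derivAmplitude a ψ s u (x + t • u) η * planeWave (w + t • s • u) η) t := by
    intro t
    refine (hasDerivAt_integral_of_dominated_loc_of_deriv_le
      (F := fun (t : ℝ) η => a (x + t • u) (s • η) * ψ η * planeWave (w + t • s • u) η)
      (F' := fun (t : ℝ) η =>
        derivAmplitude a ψ s u (x + t • u) η * planeWave (w + t • s • u) η)
      (bound := (freqAnnulus d).indicator fun _ => M)
      Filter.univ_mem (Eventually.of_forall fun t => (hFcont _ _).aestronglyMeasurable)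
      ?_ ?_ ?_ ?_ ?_).2
    · exact (hFcont _ _).integrable_of_hasCompactSupport (hcs.mul_left.mul_right)
    · exact ((hamp s hs u _).1.continuous.mul (continuous_planeWave _)).aestronglyMeasurable
    · refine ae_of_all _ fun η t _ => ?_
      rw [norm_mul, norm_planeWave, mul_one]
      by_cases hη : η ∈ freqAnnulus d
      · rw [Set.indicator_of_mem hη, ← norm_iteratedFDeriv_zero (𝕜 := ℝ)]
        exact (hamp s hs u _).2 0 N.zero_le η hη
      · rw [Set.indicator_of_notMem hη, norm_le_zero_iff]
        exact not_not.1 (mt (hsupp _ η) hη)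
    · exact (integrable_indicator_iff (isClosed_freqAnnulus d).measurableSet).2
        (integrableOn_const (isCompact_freqAnnulus d).measure_lt_top.ne)
    · refine ae_of_all _ fun η t _ => ?_
      have hline : HasDerivAt (fun t : ℝ => x + t • u) u t := by
        simpa using ((hasDerivAt_id t).smul_const u).const_add x
      have ha' : HasDerivAt (fun t : ℝ => a (x + t • u) (s • η))
          (fderiv ℝ (fun x' => a x' (s • η)) (x + t • u) u) t :=
        HasFDerivAt.comp_hasDerivAt (l := fun x' => a x' (s • η)) t
          ((ha.contDiff_left (s • η)).differentiable (by simp) (x + t • u)).hasFDerivAt hline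
      refine ((ha'.mul_const (ψ η)).mul (hasDerivAt_planeWave_line w (s • u) η t)).congr_deriv ?_
      simp only [derivAmplitude]
      ring
  have hle : ∀ t ∈ Set.Ico (0 : ℝ) 1,
      ‖∫ η, derivAmplitude a ψ s u (x + t • u) η * planeWave (w + t • s • u) η‖ ≤
        (1 + B) ^ N * (C * M) / (1 + ‖w‖) ^ N := by
    intro t ht
    rw [le_div_iff₀ (by positivity), mul_comm]
    have h1 := hdecay M _ hM (hamp s hs u (x + t • u)) (hsupp _) (w + t • s • u)
    have h2 : ‖t • s • u‖ ≤ B := by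
      rw [norm_smul, norm_smul, Real.norm_of_nonneg ht.1, Real.norm_of_nonneg hs0.le]
      have : 0 ≤ s * ‖u‖ := by positivity
      nlinarith [ht.1, ht.2]
    have h3 : 1 + ‖w‖ ≤ (1 + B) * (1 + ‖w + t • s • u‖) := by
      have : ‖w‖ ≤ ‖w + t • s • u‖ + ‖t • s • u‖ := by
        simpa using norm_sub_le (w + t • s • u) (t • s • u)
      nlinarith [norm_nonneg (w + t • s • u)]
    calc _ ≤ ((1 + B) * (1 + ‖w + t • s • u‖)) ^ N *
          ‖∫ η, derivAmplitude a ψ s u (x + t • u) η * planeWave (w + t • s • u) η‖ := by gcongr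
      _ = (1 + B) ^ N * ((1 + ‖w + t • s • u‖) ^ N *
          ‖∫ η, derivAmplitude a ψ s u (x + t • u) η * planeWave (w + t • s • u) η‖) := by
            rw [mul_pow, mul_assoc]
      _ ≤ _ := mul_le_mul_of_nonneg_left h1 (by positivity)
  have hmv := norm_image_sub_le_of_norm_deriv_le_segment_01'
    (fun t _ => (hderiv t).hasDerivWithinAt) hle
  simp only [one_smul, zero_smul, add_zero] at hmv
  rw [le_div_iff₀ (by positivity), mul_comm] at hmv
  refine hmv.trans (le_of_eq ?_)
  rw [hMdef]
  ring

lemma LPhat_of_pos {d : ℕ} (D : LPData d) {k : ℕ} (hk : 1 ≤ k) (ξ : RD d) :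
    LPhat D k ξ = fourierS D.φ (((2:ℝ) ^ k)⁻¹ • ξ) := by
  obtain ⟨k, rfl⟩ := Nat.exists_eq_succ_of_ne_zero (Nat.one_le_iff_ne_zero.1 hk)
  rfl

lemma continuous_LPkernel {d : ℕ} (D : LPData d) (j : ℕ) : Continuous (LPkernel D j) := by
  cases j with
  | zero => exact D.Φ.continuous
  | succ j => exact continuous_const.mul (D.φ.continuous.comp (continuous_const_smul _))

lemma integrable_LPkernel {d : ℕ} (D : LPData d) (j : ℕ) : Integrable (LPkernel D j) := by
  cases j with
  | zero => exact D.Φ.integrable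
  | succ j =>
    exact (D.φ.integrable.comp_smul (R := (2:ℝ) ^ (j + 1)) (by positivity)).const_mul _

lemma integral_norm_LPkernel_le {d : ℕ} (D : LPData d) (j : ℕ) :
    ∫ y, ‖LPkernel D j y‖ ≤ (∫ y, ‖D.Φ y‖) + ∫ y, ‖D.φ y‖ := by
  have h₁ : 0 ≤ ∫ y, ‖D.Φ y‖ := integral_nonneg fun _ => norm_nonneg _
  have h₂ : 0 ≤ ∫ y, ‖D.φ y‖ := integral_nonneg fun _ => norm_nonneg _
  cases j with
  | zero => simpa [LPkernel] using h₂
  | succ j =>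
    have : ∫ y, ‖LPkernel D (j + 1) y‖ = ∫ y, ‖D.φ y‖ := by
      simp only [LPkernel, norm_mul, Complex.norm_real]
      rw [integral_const_mul, Measure.integral_comp_smul volume (fun y => ‖D.φ y‖),
        finrank_euclideanSpace_fin, Real.norm_of_nonneg (by positivity),
        abs_of_nonneg (by positivity), smul_eq_mul, ← mul_assoc, ← pow_mul,
        mul_inv_cancel₀ (by positivity), one_mul]
    linarith

/-- Each piece of the kernel is an average of rescaled kernels of translated symbols. -/
lemma symbolPiece_kernel {d : ℕ} {m : ℝ} (D : LPData d) {a : RD d → RD d → ℂ}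
    (ha : IsSymbolS11 d m a) (j : ℕ) {k : ℕ} (hk : 1 ≤ k) (x z : RD d) :
    Integrable (fun ξ => symbolPiece D a j k x ξ * planeWave (x - z) ξ) ∧
    Integrable (fun y => LPkernel D j y * (((2:ℝ) ^ k) ^ d •
      blockKernel a (fourierS D.φ) (2 ^ k) (x - y) ((2:ℝ) ^ k • (x - z)))) ∧
    ∫ ξ, symbolPiece D a j k x ξ * planeWave (x - z) ξ =
      ∫ y, LPkernel D j y * (((2:ℝ) ^ k) ^ d •
        blockKernel a (fourierS D.φ) (2 ^ k) (x - y) ((2:ℝ) ^ k • (x - z))) := by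
  set s : ℝ := 2 ^ k with hs
  have hs0 : 0 < s := by positivity
  set ψ := fourierS D.φ
  have hcs : HasCompactSupport ψ := (isCompact_freqAnnulus d).of_isClosed_subset
    (isClosed_tsupport ψ) (closure_minimal D.supp_φ (isClosed_freqAnnulus d))
  have hψc : Continuous fun ξ : RD d => ψ (s⁻¹ • ξ) :=
    ψ.continuous.comp (continuous_const_smul _)
  obtain ⟨c, hc, hbound⟩ := ha.exists_bound_zero 0
  let G : RD d → RD d → ℂ := fun ξ y =>
    LPkernel D j y * (a (x - y) ξ * ψ (s⁻¹ • ξ) * planeWave (x - z) ξ)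
  have hweight : Integrable fun ξ : RD d => (c * (1 + ‖ξ‖) ^ m) * ‖ψ (s⁻¹ • ξ)‖ := by
    refine Continuous.integrable_of_hasCompactSupport ?_ ?_
    · refine Continuous.mul (continuous_const.mul ?_) hψc.norm
      exact (continuous_const.add continuous_norm).rpow_const fun ξ =>
        Or.inl (add_pos_of_pos_of_nonneg one_pos (norm_nonneg ξ)).ne'
    · exact ((hcs.comp_smul (inv_ne_zero hs0.ne')).norm).mul_left
  have hG : Integrable (Function.uncurry G) (volume.prod volume) := by
    refine (hweight.mul_prod (integrable_LPkernel D j).norm).mono' ?_ (ae_of_all _ ?_)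
    · refine Continuous.aestronglyMeasurable ?_
      refine ((continuous_LPkernel D j).comp continuous_snd).mul
        ((Continuous.mul ?_ (hψc.comp continuous_fst)).mul
          ((continuous_planeWave _).comp continuous_fst))
      exact ha.1.continuous.comp
        (((continuous_const.sub continuous_snd)).prodMk continuous_fst)
    · rintro ⟨ξ, y⟩
      have h := hbound 0 le_rfl (x - y) ξ
      rw [norm_iteratedFDeriv_zero, Nat.cast_zero, sub_zero] at h
      simp only [Function.uncurry_apply_pair, G, norm_mul, norm_planeWave, mul_one]
      rw [mul_comm ‖LPkernel D j y‖]
      gcongr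
  have hpiece : ∀ ξ, symbolPiece D a j k x ξ * planeWave (x - z) ξ = ∫ y, G ξ y := by
    intro ξ
    rw [symbolPiece, LPhat_of_pos D hk, ← integral_mul_const, ← integral_mul_const]
    refine integral_congr_ae (ae_of_all _ fun y => ?_)
    simp only [G, ψ, hs]
    ring
  have hblock : ∀ y, LPkernel D j y * (s ^ d • blockKernel a ψ s (x - y) (s • (x - z))) =
      ∫ ξ, G ξ y := by
    intro y
    simp only [G]
    rw [integral_const_mul]
    congr 1
    have hcv := Measure.integral_comp_smul volume
      (fun ξ : RD d => a (x - y) ξ * ψ (s⁻¹ • ξ) * planeWave (x - z) ξ) s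
    rw [finrank_euclideanSpace_fin, abs_of_nonneg (by positivity)] at hcv
    have hb : blockKernel a ψ s (x - y) (s • (x - z)) =
        ∫ η, a (x - y) (s • η) * ψ (s⁻¹ • s • η) * planeWave (x - z) (s • η) := by
      refine integral_congr_ae (ae_of_all _ fun η => ?_)
      simp only [inv_smul_smul₀ hs0.ne', planeWave, real_inner_smul_left, real_inner_smul_right]
    rw [hb, hcv, smul_inv_smul₀ (by positivity)]
  simp only [hpiece, hblock]
  exact ⟨hG.integral_prod_left, hG.integral_prod_right, integral_integral_swap hG⟩

lemma Ukernel_eq_sum {d : ℕ} {m : ℝ} (D : LPData d) {a : RD d → RD d → ℂ}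
    (ha : IsSymbolS11 d m a) {k : ℕ} (hk : 1 ≤ k) (x z : RD d) :
    Ukernel D a k x z = ∑ j ∈ Finset.Icc (k - 2) (k + 2),
      ∫ y, LPkernel D j y * (((2:ℝ) ^ k) ^ d •
        blockKernel a (fourierS D.φ) (2 ^ k) (x - y) ((2:ℝ) ^ k • (x - z))) := by
  have h : Ukernel D a k x z =
      ∫ ξ, ∑ j ∈ Finset.Icc (k - 2) (k + 2), symbolPiece D a j k x ξ * planeWave (x - z) ξ := by
    refine integral_congr_ae (ae_of_all _ fun ξ => ?_)
    simp only [dsym, planeWave, Finset.sum_mul]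
  rw [h, integral_finsetSum _ fun j _ => (symbolPiece_kernel D ha j hk x z).1]
  exact Finset.sum_congr rfl fun j _ => (symbolPiece_kernel D ha j hk x z).2.2

lemma exists_Ukernel_sub_le {d : ℕ} {m : ℝ} (D : LPData d) {a : RD d → RD d → ℂ}
    (ha : IsSymbolS11 d m a) (N : ℕ) {B : ℝ} (hB : 0 ≤ B) :
    ∃ C, 0 ≤ C ∧ ∀ k : ℕ, 1 ≤ k → ∀ x y z : RD d, 2 ^ k * ‖x - y‖ ≤ B →
      ‖Ukernel D a k x z - Ukernel D a k y z‖ ≤ C * (((2:ℝ) ^ k) ^ m * (2 ^ k * ‖x - y‖)) *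
        (((2:ℝ) ^ k) ^ d * (1 + ‖(2:ℝ) ^ k • (y - z)‖) ^ (-(N : ℝ))) := by
  obtain ⟨C, hC, hblock⟩ := exists_blockKernel_sub_le ha (fourierS D.φ) D.supp_φ N hB
  set I := (∫ y, ‖D.Φ y‖) + ∫ y, ‖D.φ y‖
  have hI : 0 ≤ I := add_nonneg (integral_nonneg fun _ => norm_nonneg _)
    (integral_nonneg fun _ => norm_nonneg _)
  refine ⟨5 * I * C, by positivity, fun k hk x y z hxy => ?_⟩
  set s : ℝ := 2 ^ k with hs
  have hs1 : 1 ≤ s := one_le_pow₀ (by norm_num)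
  have hs0 : 0 < s := by positivity
  set T := s ^ d * (C * (s ^ m * (s * ‖x - y‖)) / (1 + ‖s • (y - z)‖) ^ N) with hT
  have hT0 : 0 ≤ T := by positivity
  rw [Ukernel_eq_sum D ha hk, Ukernel_eq_sum D ha hk, ← Finset.sum_sub_distrib]
  have hterm : ∀ j ∈ Finset.Icc (k - 2) (k + 2),
      ‖(∫ w, LPkernel D j w * (s ^ d • blockKernel a (fourierS D.φ) s (x - w) (s • (x - z)))) -
        ∫ w, LPkernel D j w * (s ^ d • blockKernel a (fourierS D.φ) s (y - w) (s • (y - z)))‖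
      ≤ I * T := by
    intro j _
    rw [← integral_sub (symbolPiece_kernel D ha j hk x z).2.1
      (symbolPiece_kernel D ha j hk y z).2.1]
    have hle : ∀ w, ‖LPkernel D j w *
          (s ^ d • blockKernel a (fourierS D.φ) s (x - w) (s • (x - z))) -
        LPkernel D j w * (s ^ d • blockKernel a (fourierS D.φ) s (y - w) (s • (y - z)))‖
        ≤ ‖LPkernel D j w‖ * T := by
      intro w
      rw [← mul_sub, ← smul_sub, norm_mul, norm_smul, norm_pow, Real.norm_of_nonneg hs0.le, hT]
      gcongr
      rw [le_div_iff₀ (by positivity), mul_comm]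
      have := hblock s hs1 (x - y) (y - w) (s • (y - z)) hxy
      rwa [← smul_add, show y - w + (x - y) = x - w by abel,
        show y - z + (x - y) = x - z by abel] at this
    refine (norm_integral_le_of_norm_le ((integrable_LPkernel D j).norm.mul_const T)
      (ae_of_all _ hle)).trans ?_
    rw [integral_mul_const]
    gcongr
    exact integral_norm_LPkernel_le D j
  refine (norm_sum_le _ _).trans ((Finset.sum_le_card_nsmul _ _ _ hterm).trans ?_)
  have hcard : ((Finset.Icc (k - 2) (k + 2)).card : ℝ) ≤ 5 := by
    rw [Nat.card_Icc]
    exact_mod_cast (by omega : k + 2 + 1 - (k - 2) ≤ 5)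
  rw [nsmul_eq_mul]
  calc _ ≤ 5 * (I * T) := by gcongr
    _ = _ := by
      rw [hT, Real.rpow_neg (by positivity), Real.rpow_natCast]
      ring

lemma norm_sub_le_of_mem_cube {d : ℕ} {c : RD d} {L : ℝ} (hL : 0 ≤ L) {x y : RD d}
    (hx : x ∈ cube d c L) (hy : y ∈ cube d c L) : ‖x - y‖ ≤ √d * L := by
  rw [EuclideanSpace.norm_eq]
  refine Real.sqrt_le_iff.2 ⟨by positivity, ?_⟩
  rw [mul_pow, Real.sq_sqrt (Nat.cast_nonneg d)]
  have : ∀ i ∈ Finset.univ, ‖(x - y) i‖ ^ 2 ≤ L ^ 2 := fun i _ => by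
    rw [Real.norm_eq_abs, sq_abs]
    refine sq_le_sq' ?_ ?_ <;> simp only [PiLp.sub_apply] <;> linarith [hx i, hy i]
  simpa using Finset.sum_le_card_nsmul _ _ _ this

/-- the kernel regularity estimate
`∫ |U_k(x,z) - U_k(y,z)| dz ≤ C 2^{km} 2^k l(Q)` for `x,y` in a cube `Q` with
`2^{-μ} ≤ l(Q) < 2^{-μ+1}` and `1 ≤ k ≤ μ`. -/
theorem statement17 (d : ℕ) (hd : 1 ≤ d) (m : ℝ)
    (D : LPData d) (a : RD d → RD d → ℂ) (ha : IsSymbolS11 d m a) :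
    ∃ C : ℝ≥0, ∀ μ : ℕ, 1 ≤ μ → ∀ (c : RD d) (L : ℝ),
      (2:ℝ)^(-(μ:ℤ)) ≤ L → L < (2:ℝ)^(-(μ:ℤ)+1) →
      ∀ k : ℕ, 1 ≤ k → k ≤ μ → ∀ x y : RD d, x ∈ cube d c L → y ∈ cube d c L →
        (∫⁻ z, (‖Ukernel D a k x z - Ukernel D a k y z‖₊ : ℝ≥0∞)) ≤
          (C : ℝ≥0∞) * (2:ℝ≥0∞)^((k:ℝ)*m) * ((2:ℝ≥0∞)^((k:ℝ)) * ENNReal.ofReal L) := by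
  set B : ℝ := 2 * √d with hBdef
  obtain ⟨C, hC, hU⟩ := exists_Ukernel_sub_le D ha (d + 1) (B := B) (by positivity)
  set w : RD d → ℝ := fun u => (1 + ‖u‖) ^ (-((d + 1 : ℕ) : ℝ))
  have hw0 : ∀ u, 0 ≤ w u := fun u => by positivity
  have hwint : Integrable w := integrable_one_add_norm (by simp)
  set J := ∫ u, w u
  have hJ : 0 ≤ J := integral_nonneg hw0
  refine ⟨(C * √d * J).toNNReal, fun μ hμ c L hL₁ hL₂ k hk hkμ x y hx hy => ?_⟩
  have hL0 : 0 < L := lt_of_lt_of_le (by positivity) hL₁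
  have hxy := norm_sub_le_of_mem_cube hL0.le hx hy
  set s : ℝ := 2 ^ k with hs
  have hs0 : 0 < s := by positivity
  have hsL : s * L ≤ 2 := by
    calc s * L ≤ 2 ^ μ * 2 ^ (-(μ:ℤ) + 1) := by
          rw [hs]
          gcongr
          norm_num
      _ = 2 := by
          rw [zpow_add₀ two_ne_zero, zpow_neg, zpow_natCast, zpow_one, ← mul_assoc,
            mul_inv_cancel₀ (by positivity), one_mul]
  have hsxy : s * ‖x - y‖ ≤ √d * (s * L) := by
    calc s * ‖x - y‖ ≤ s * (√d * L) := by gcongr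
      _ = _ := by ring
  have hsB : s * ‖x - y‖ ≤ B := hsxy.trans (by rw [hBdef, mul_comm 2]; gcongr)
  set A := C * (s ^ m * (√d * (s * L))) with hA
  have hA0 : 0 ≤ A := by positivity
  have hint : Integrable fun z => A * (s ^ d * w (s • (y - z))) :=
    (((hwint.comp_smul hs0.ne').comp_sub_left y).const_mul _).const_mul _
  have hval : ∫ z, A * (s ^ d * w (s • (y - z))) = A * J := by
    rw [integral_const_mul, integral_const_mul,
      integral_sub_left_eq_self (fun z => w (s • z)) volume y,
      Measure.integral_comp_smul, finrank_euclideanSpace_fin, abs_of_nonneg (by positivity),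
      smul_eq_mul, mul_inv_cancel_left₀ (by positivity)]
  calc ∫⁻ z, (‖Ukernel D a k x z - Ukernel D a k y z‖₊ : ℝ≥0∞)
      ≤ ∫⁻ z, ENNReal.ofReal (A * (s ^ d * w (s • (y - z)))) := by
        refine lintegral_mono fun z => ?_
        rw [← enorm_eq_nnnorm, ← ofReal_norm]
        refine ENNReal.ofReal_le_ofReal ((hU k hk x y z hsB).trans ?_)
        rw [hA]
        have := hw0 (s • (y - z))
        gcongr
    _ = ENNReal.ofReal (A * J) := by
        rw [← ofReal_integral_eq_lintegral_ofReal hint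
          (ae_of_all _ fun z => mul_nonneg hA0 (mul_nonneg (by positivity) (hw0 _))), hval]
    _ = ENNReal.ofReal (C * √d * J * (2:ℝ) ^ ((k:ℝ) * m) * ((2:ℝ) ^ (k:ℝ) * L)) := by
        congr 1
        rw [hA, Real.rpow_mul zero_le_two, Real.rpow_natCast]
        ring
    _ = _ := by
        rw [ENNReal.ofReal_mul (by positivity),
          ENNReal.ofReal_mul (p := C * √d * J) (by positivity),
          ENNReal.ofReal_mul (p := (2:ℝ) ^ (k:ℝ)) (by positivity),
          ← ENNReal.ofReal_rpow_of_pos two_pos, ← ENNReal.ofReal_rpow_of_pos two_pos,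
          ENNReal.ofReal_ofNat, ENNReal.ofReal]

end
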